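/- arXiv:2310.18041 — 2 statements merged into one kernel-verified Lean document; each statement's English description precedes it below -/
import Mathlib

section
/- Let I = (−ρ, ρ) where 0 < ρ ≤ ∞, and let k be a non-negative integer. For a function f : I → ℝ, the following are equivalent: (1) for every n ≥ max(k,1) and every matrix A ∈ S_n^{(k)}(I), the entrywise transform f[A] has the same inertia as A (the same number of positive eigenvalues, the same number of negative eigenvalues, and the same number of zero eigenvalues, all counted with multiplicity); (2) there exists a constant c > 0 such that f(x) = c·x for all x ∈ I. -/
/-- The number of negative eigenvalues (with multiplicity) of a real symmetric
(Hermitian) matrix; junk value `0` if the matrix is not Hermitian. -/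
noncomputable def negEigCount {n : Type*} [Fintype n] [DecidableEq n]
    (A : Matrix n n ℝ) : ℕ :=
  if hA : A.IsHermitian then Nat.card {i // hA.eigenvalues i < 0} else 0

/-- Membership in the interval `(-ρ, ρ)` for `ρ : EReal` (so `ρ = ∞` is allowed). -/
def memI (ρ : EReal) (x : ℝ) : Prop := -ρ < (x : EReal) ∧ (x : EReal) < ρ

/-- The number of positive eigenvalues (with multiplicity). -/
noncomputable def posEigCount {n : Type*} [Fintype n] [DecidableEq n]
    (A : Matrix n n ℝ) : ℕ :=
  if hA : A.IsHermitian then Nat.card {i // 0 < hA.eigenvalues i} else 0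

/-- The number of zero eigenvalues (with multiplicity). -/
noncomputable def zeroEigCount {n : Type*} [Fintype n] [DecidableEq n]
    (A : Matrix n n ℝ) : ℕ :=
  if hA : A.IsHermitian then Nat.card {i // hA.eigenvalues i = 0} else 0

open Matrix Polynomial

section Counts

variable {m n : Type*} [Fintype m] [DecidableEq m] [Fintype n] [DecidableEq n]

lemma card_eigenvalues_eq_countP_roots {A : Matrix n n ℝ} (hA : A.IsHermitian)
    (p : ℝ → Prop) [DecidablePred p] :
    Nat.card {i // p (hA.eigenvalues i)} = A.charpoly.roots.countP p := by
  rw [hA.roots_charpoly_eq_eigenvalues, Multiset.countP_map, Nat.card_eq_fintype_card,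
    Fintype.card_subtype]
  rfl

lemma negEigCount_eq_countP_roots {A : Matrix n n ℝ} (hA : A.IsHermitian) :
    negEigCount A = A.charpoly.roots.countP (· < 0) := by
  rw [negEigCount, dif_pos hA, card_eigenvalues_eq_countP_roots hA (· < 0)]

lemma posEigCount_eq_countP_roots {A : Matrix n n ℝ} (hA : A.IsHermitian) :
    posEigCount A = A.charpoly.roots.countP (0 < ·) := by
  rw [posEigCount, dif_pos hA, card_eigenvalues_eq_countP_roots hA (0 < ·)]

lemma zeroEigCount_eq_countP_roots {A : Matrix n n ℝ} (hA : A.IsHermitian) :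
    zeroEigCount A = A.charpoly.roots.countP (· = 0) := by
  rw [zeroEigCount, dif_pos hA, card_eigenvalues_eq_countP_roots hA (· = 0)]

lemma zeroEigCount_eq_zero_iff_det_ne_zero {A : Matrix n n ℝ} (hA : A.IsHermitian) :
    zeroEigCount A = 0 ↔ A.det ≠ 0 := by
  rw [zeroEigCount, dif_pos hA, hA.det_eq_prod_eigenvalues, Finset.prod_ne_zero_iff,
    Nat.card_eq_zero, or_iff_left (not_infinite_iff_finite.2 inferInstance), isEmpty_subtype]
  simp

lemma negEigCount_reindex {A : Matrix n n ℝ} (hA : A.IsHermitian) (e : n ≃ m) :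
    negEigCount (A.reindex e e) = negEigCount A := by
  rw [negEigCount_eq_countP_roots hA, negEigCount_eq_countP_roots (A := A.reindex e e)
    (hA.submatrix _), charpoly_reindex]

lemma negEigCount_fromBlocks {A : Matrix m m ℝ} {D : Matrix n n ℝ} (hA : A.IsHermitian)
    (hD : D.IsHermitian) :
    negEigCount (fromBlocks A 0 0 D) = negEigCount A + negEigCount D := by
  rw [negEigCount_eq_countP_roots hA, negEigCount_eq_countP_roots hD,
    negEigCount_eq_countP_roots (hA.fromBlocks (by simp) hD), charpoly_fromBlocks_zero₁₂,
    roots_mul (mul_ne_zero A.charpoly_monic.ne_zero D.charpoly_monic.ne_zero),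
    Multiset.countP_add]

lemma negEigCount_diagonal (d : n → ℝ) :
    negEigCount (diagonal d) = (Finset.univ.filter fun i => d i < 0).card := by
  rw [negEigCount_eq_countP_roots (isHermitian_diagonal d), charpoly_diagonal, roots_prod _ _
    (by simp [Finset.prod_ne_zero_iff, X_sub_C_ne_zero])]
  simp only [roots_X_sub_C, Multiset.bind_singleton, Multiset.countP_map]
  rfl

lemma negEigCount_eq_zero_of_posSemidef {A : Matrix n n ℝ} (hA : A.PosSemidef) :
    negEigCount A = 0 := by
  rw [negEigCount, dif_pos hA.1, Nat.card_eq_zero]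
  exact Or.inl ⟨fun i => (hA.eigenvalues_nonneg i.1).not_gt i.2⟩

lemma negEigCount_antidiagonal {t : ℝ} (ht : 0 < t) :
    negEigCount !![0, -t; -t, 0] = 1 := by
  have h : (!![0, -t; -t, 0] : Matrix (Fin 2) (Fin 2) ℝ).charpoly
      = (X - C t) * (X - C (-t)) := by
    rw [charpoly_fin_two]
    simp [trace_fin_two, det_fin_two]
    ring
  rw [negEigCount_eq_countP_roots (by ext i j; fin_cases i <;> fin_cases j <;> simp), h,
    roots_mul (mul_ne_zero (X_sub_C_ne_zero _) (X_sub_C_ne_zero _)), roots_X_sub_C,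
    roots_X_sub_C, Multiset.countP_add, ← Multiset.cons_zero, ← Multiset.cons_zero,
    Multiset.countP_cons_of_neg (p := (· < 0)) _ ht.not_gt,
    Multiset.countP_cons_of_pos (p := (· < 0)) _ (neg_neg_of_pos ht)]
  simp

lemma roots_charpoly_smul {A : Matrix n n ℝ} (hA : A.IsHermitian) (c : ℝ) :
    (c • A).charpoly.roots = A.charpoly.roots.map (c * ·) := by
  have h : cfc (fun x : ℝ => c * x) A = c • A := cfc_const_mul_id c A hA
  rw [← h, hA.charpoly_cfc_eq, roots_prod _ _
    (Finset.prod_ne_zero_iff.2 fun _ _ => X_sub_C_ne_zero _), hA.roots_charpoly_eq_eigenvalues]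
  simp only [roots_X_sub_C, Multiset.bind_singleton, Multiset.map_map]
  rfl

lemma eigCounts_smul {A : Matrix n n ℝ} (hA : A.IsHermitian) {c : ℝ} (hc : 0 < c) :
    posEigCount (c • A) = posEigCount A ∧ negEigCount (c • A) = negEigCount A ∧
      zeroEigCount (c • A) = zeroEigCount A := by
  have hcA : (c • A).IsHermitian := by
    rw [Matrix.IsHermitian, conjTranspose_smul, hA.eq, star_trivial]
  rw [posEigCount_eq_countP_roots hA, negEigCount_eq_countP_roots hA,
    zeroEigCount_eq_countP_roots hA, posEigCount_eq_countP_roots hcA,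
    negEigCount_eq_countP_roots hcA, zeroEigCount_eq_countP_roots hcA, roots_charpoly_smul hA]
  simp only [Multiset.countP_map, ← Multiset.countP_eq_card_filter, mul_pos_iff_of_pos_left hc,
    mul_eq_zero, hc.ne', false_or]
  refine ⟨trivial, ?_, trivial⟩
  congr 1
  ext x
  exact ⟨fun h => by nlinarith, fun h => mul_neg_of_pos_of_neg hc h⟩

end Counts

section Interval

lemma memI_iff_abs_lt {ρ : EReal} {x : ℝ} : memI ρ x ↔ ((|x| : ℝ) : EReal) < ρ := by
  rw [memI, EReal.neg_lt_comm, ← EReal.coe_neg]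
  rcases abs_cases x with ⟨h, hx⟩ | ⟨h, hx⟩ <;> rw [h]
  · exact ⟨fun h => h.2, fun h => ⟨lt_of_le_of_lt (by exact_mod_cast (by linarith)) h, h⟩⟩
  · exact ⟨fun h => h.1, fun h => ⟨h, lt_of_le_of_lt (by exact_mod_cast (by linarith)) h⟩⟩

lemma memI.of_abs_le {ρ : EReal} {x y : ℝ} (hx : memI ρ x) (h : |y| ≤ |x|) : memI ρ y :=
  memI_iff_abs_lt.2 (lt_of_le_of_lt (by exact_mod_cast h) (memI_iff_abs_lt.1 hx))

lemma memI_zero {ρ : EReal} (hρ : 0 < ρ) : memI ρ 0 := by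
  simpa [memI_iff_abs_lt] using hρ

lemma memI.exists_gt {ρ : EReal} {x : ℝ} (hx : memI ρ x) : ∃ y, |x| < y ∧ memI ρ y := by
  obtain ⟨y, hxy, hy⟩ := EReal.lt_iff_exists_real_btwn.1 (memI_iff_abs_lt.1 hx)
  have hxy : |x| < y := by exact_mod_cast hxy
  refine ⟨y, hxy, memI_iff_abs_lt.2 ?_⟩
  rwa [abs_of_pos ((abs_nonneg x).trans_lt hxy)]

/-- A positive additive function on `(0, ρ)` is linear there. -/
lemma mul_eq_mul_of_additive_of_pos {ρ : EReal} {f : ℝ → ℝ}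
    (hpos : ∀ x, 0 < x → memI ρ x → 0 < f x)
    (hadd : ∀ x y, 0 < x → 0 < y → memI ρ (x + y) → f (x + y) = f x + f y)
    {x y : ℝ} (hx : 0 < x) (hy : 0 < y) (hxI : memI ρ x) (hyI : memI ρ y) :
    y * f x = x * f y := by
  have hnat : ∀ (n : ℕ) (h : ℝ), 0 < h → memI ρ ((n + 1) * h) →
      f ((n + 1) * h) = (n + 1) * f h := by
    intro n h hh
    induction n with
    | zero => simp
    | succ n ih =>
      intro hI
      push_cast at hI ⊢
      have h1 : 0 < ((n : ℝ) + 1) * h := by positivity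
      have e : ((n : ℝ) + 1 + 1) * h = (n + 1) * h + h := by ring
      rw [e] at hI ⊢
      rw [hadd _ _ h1 hh hI, ih (hI.of_abs_le (abs_le_abs_of_nonneg h1.le (by linarith)))]
      ring
  have hmono : ∀ x y, 0 < x → x ≤ y → memI ρ y → f x ≤ f y := by
    intro x y hx hxy hy
    rcases hxy.eq_or_lt with rfl | hlt
    · exact le_rfl
    · have h1 := hadd x (y - x) hx (by linarith) (by simpa using hy)
      rw [add_sub_cancel] at h1
      have h2 := hpos (y - x) (by linarith)
        (hy.of_abs_le (abs_le_abs_of_nonneg (by linarith) (by linarith)))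
      linarith
  have key : ∀ x y, 0 < x → 0 < y → memI ρ x → memI ρ y → y * f x ≤ x * f y := by
    intro x y hx hy hxI hyI
    by_contra! hlt
    obtain ⟨n, hn⟩ := exists_nat_gt (x * f x / (y * f x - x * f y))
    rw [div_lt_iff₀ (by linarith)] at hn
    have hfx := hpos x hx hxI
    have hfy := hpos y hy hyI
    have hn0 : 0 < n := by
      rcases Nat.eq_zero_or_pos n with rfl | h
      · have := mul_pos hx hfx
        simp at hn
        linarith
      · exact h
    obtain ⟨N, rfl⟩ := Nat.exists_eq_succ_of_ne_zero hn0.ne'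
    push_cast at hn
    set h := x / ((N : ℝ) + 1) with hh
    have hN : (0 : ℝ) < N + 1 := by positivity
    have hhpos : 0 < h := by positivity
    have hxh : ((N : ℝ) + 1) * h = x := by rw [hh]; field_simp
    have hfh := hnat N h hhpos (by rwa [hxh])
    rw [hxh] at hfh
    have hhI : memI ρ h := hxI.of_abs_le
      (abs_le_abs_of_nonneg hhpos.le (by nlinarith [Nat.cast_nonneg (α := ℝ) N]))
    have hfhpos := hpos h hhpos hhI
    have hfl := Nat.lt_floor_add_one (y / h)
    have hfl' := Nat.floor_le (div_pos hy hhpos).le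
    rw [div_lt_iff₀ hhpos] at hfl
    rw [le_div_iff₀ hhpos] at hfl'
    have hle : (⌊y / h⌋₊ : ℝ) * f h ≤ f y := by
      rcases Nat.eq_zero_or_pos ⌊y / h⌋₊ with h0 | h0
      · rw [h0]; simpa using hfy.le
      · obtain ⟨M, hM⟩ := Nat.exists_eq_succ_of_ne_zero h0.ne'
        rw [hM] at hfl' ⊢
        push_cast at hfl' ⊢
        have h1 : 0 < ((M : ℝ) + 1) * h := by positivity
        rw [← hnat M h hhpos (hyI.of_abs_le (abs_le_abs_of_nonneg h1.le hfl'))]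
        exact hmono _ _ h1 hfl' hyI
    have h3 : y * f h ≤ h * f y + h * f h := by nlinarith
    have h4 : ((N : ℝ) + 1) ^ 2 * (y * f h) ≤ ((N : ℝ) + 1) ^ 2 * (h * f y + h * f h) := by
      gcongr
    rw [hfh] at hn
    rw [← hxh] at hn
    nlinarith
  exact le_antisymm (key x y hx hy hxI hyI) (key y x hy hx hyI hxI)

end Interval

section Preserver

/-- `f` preserves, entrywise, the number of negative eigenvalues and the vanishing of the
determinant of symmetric matrices with entries in `(-ρ, ρ)` and `k` negative eigenvalues. -/
def PreservesNegDet (ρ : EReal) (k : ℕ) (f : ℝ → ℝ) : Prop :=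
  ∀ (ι : Type) [Fintype ι] [DecidableEq ι] (A : Matrix ι ι ℝ), max k 1 ≤ Fintype.card ι →
    A.IsHermitian → (∀ i j, memI ρ (A i j)) → negEigCount A = k →
    negEigCount (A.map f) = k ∧ ((A.map f).det = 0 ↔ A.det = 0)

lemma isHermitian_map {n : Type*} {A : Matrix n n ℝ} (hA : A.IsHermitian) (f : ℝ → ℝ) :
    (A.map f).IsHermitian := hA.map f fun _ => rfl

lemma preservesNegDet_of_inertia {ρ : EReal} {k : ℕ} {f : ℝ → ℝ}
    (H : ∀ n : ℕ, max k 1 ≤ n → ∀ A : Matrix (Fin n) (Fin n) ℝ,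
        A.IsSymm → (∀ i j, memI ρ (A i j)) → negEigCount A = k →
        (posEigCount (A.map f) = posEigCount A ∧
         negEigCount (A.map f) = negEigCount A ∧
         zeroEigCount (A.map f) = zeroEigCount A)) :
    PreservesNegDet ρ k f := by
  intro ι _ _ A hcard hA hI hneg
  let e := Fintype.equivFin ι
  have hB : (A.reindex e e).IsHermitian := hA.submatrix _
  obtain ⟨-, h1, h2⟩ := H _ hcard (A.reindex e e)
    (by simpa [Matrix.IsHermitian, Matrix.IsSymm, conjTranspose_eq_transpose_of_trivial] using hB)
    (fun i j => hI _ _) (by rw [negEigCount_reindex hA, hneg])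
  have hmap : (A.reindex e e).map f = (A.map f).reindex e e := rfl
  constructor
  · rw [← negEigCount_reindex (isHermitian_map hA f) e, ← hmap, h1, negEigCount_reindex hA, hneg]
  · have h3 := zeroEigCount_eq_zero_iff_det_ne_zero (isHermitian_map hB f)
    rw [h2, zeroEigCount_eq_zero_iff_det_ne_zero hB, hmap, det_reindex_self,
      det_reindex_self] at h3
    exact (not_iff_not.1 h3).symm

variable {ρ : EReal} {k : ℕ} {f : ℝ → ℝ}

lemma PreservesNegDet.map_neg_eq (H : PreservesNegDet ρ k f) (h0 : f 0 ≠ 0) {t : ℝ} (ht : 0 < t)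
    (htI : memI ρ t) : k ≠ 0 ∧ f (-t) = f 0 := by
  have htI' : memI ρ (-t) := htI.of_abs_le (by simp)
  have h0I : memI ρ 0 := htI.of_abs_le (by simp)
  let d : Fin k ⊕ Unit → ℝ := Sum.elim (fun _ => -t) (fun _ => 0)
  obtain ⟨-, hdet⟩ := H (Fin k ⊕ Unit) (diagonal d) (by simp) (isHermitian_diagonal d)
    (by
      intro i j
      rw [diagonal_apply]
      split_ifs
      · rcases i with i | i
        · exact htI'
        · exact h0I
      · exact h0I)
    (by
      rw [negEigCount_diagonal, Finset.card_filter, Fintype.sum_sum_type]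
      simp [d, ht])
  have hdet0 := hdet.2 (by
    rw [det_diagonal]
    exact Finset.prod_eq_zero (Finset.mem_univ (Sum.inr ())) rfl)
  obtain ⟨v, hv, hmul⟩ := exists_mulVec_eq_zero_iff.2 hdet0
  have hrow : ∀ i, f 0 * ∑ j, v j + (f (d i) - f 0) * v i = 0 := by
    intro i
    have h : ∑ j, (diagonal d).map f i j * v j = 0 := congrFun hmul i
    have hentry : ∀ j, (diagonal d).map f i j * v j =
        f 0 * v j + if i = j then (f (d j) - f 0) * v j else 0 := by
      intro j
      by_cases hij : i = j
      · subst hij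
        simp
        ring
      · simp [hij]
    rw [Finset.sum_congr rfl fun j _ => hentry j, Finset.sum_add_distrib, ← Finset.mul_sum,
      Finset.sum_ite_eq, if_pos (Finset.mem_univ i)] at h
    exact h
  have hsum : ∑ j, v j = 0 := by simpa [d, h0] using hrow (Sum.inr ())
  have hinl : f (-t) ≠ f 0 → ∀ i, v (Sum.inl i) = 0 := fun hne i => by
    simpa [hsum, d, sub_ne_zero.2 hne] using hrow (Sum.inl i)
  have hno : ¬ ∀ i, v (Sum.inl i) = 0 := by
    intro h
    apply hv
    have h1 : v (Sum.inr ()) = 0 := by simpa [h] using hsum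
    ext i
    rcases i with i | i
    · exact h i
    · exact h1
  refine ⟨?_, by_contra fun hne => hno (hinl hne)⟩
  rintro rfl
  exact hno fun i => i.elim0

lemma PreservesNegDet.map_zero (H : PreservesNegDet ρ k f) (hρ : 0 < ρ) : f 0 = 0 := by
  by_contra h0
  obtain ⟨t, ht, htI⟩ := (memI_zero hρ).exists_gt
  rw [abs_zero] at ht
  obtain ⟨hk, hft⟩ := H.map_neg_eq h0 ht htI
  obtain ⟨k, rfl⟩ := Nat.exists_eq_succ_of_ne_zero hk
  have htI' : memI ρ (-t) := htI.of_abs_le (by simp)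
  let A : Matrix (Fin 2 ⊕ Fin k) (Fin 2 ⊕ Fin k) ℝ :=
    fromBlocks !![0, -t; -t, 0] 0 0 (diagonal fun _ => -t)
  have hB : (!![0, -t; -t, 0] : Matrix (Fin 2) (Fin 2) ℝ).IsHermitian := by
    ext i j; fin_cases i <;> fin_cases j <;> simp
  have hA : ∀ i j, A i j = 0 ∨ A i j = -t := by
    rintro (i | i) (j | j)
    · fin_cases i <;> fin_cases j <;> simp [A]
    · simp [A]
    · simp [A]
    · by_cases h : i = j <;> simp [A, h]
  obtain ⟨-, hdet⟩ := H _ A (by simp)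
    (hB.fromBlocks (by simp) (isHermitian_diagonal _))
    (by
      intro i j
      rcases hA i j with h | h <;> rw [h]
      · exact memI_zero hρ
      · exact htI')
    (by
      rw [negEigCount_fromBlocks hB (isHermitian_diagonal _), negEigCount_antidiagonal ht,
        negEigCount_diagonal]
      simp [ht, add_comm])
  have hmap : ∀ i j, A.map f i j = f 0 := by
    intro i j
    rcases hA i j with h | h <;> simp [h, hft]
  have h1 := hdet.1 (det_zero_of_row_eq (i := Sum.inl 0) (j := Sum.inl 1) (by simp)
    (by ext j; rw [hmap, hmap]))
  simp [A, det_fin_two, ht.ne'] at h1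

lemma PreservesNegDet.det_map_eq_zero_iff (H : PreservesNegDet ρ k f) (hρ : 0 < ρ)
    {ι : Type} [Fintype ι] [DecidableEq ι] [Nonempty ι] {A : Matrix ι ι ℝ} (hA : A.PosSemidef)
    (hI : ∀ i j, memI ρ (A i j)) : (A.map f).det = 0 ↔ A.det = 0 := by
  have h0 := H.map_zero hρ
  obtain ⟨t, ht, htI⟩ := (memI_zero hρ).exists_gt
  rw [abs_zero] at ht
  have htI' : memI ρ (-t) := htI.of_abs_le (by simp)
  have h1 := (H (ι ⊕ Fin k) (fromBlocks A 0 0 (diagonal fun _ => -t))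
    (by simp; have := Fintype.card_pos (α := ι); omega)
    (hA.1.fromBlocks (by simp) (isHermitian_diagonal _))
    (by
      rintro (i | i) (j | j)
      · exact hI i j
      · exact memI_zero hρ
      · exact memI_zero hρ
      · by_cases h : i = j
        · simpa [h] using htI'
        · simpa [h] using memI_zero hρ)
    (by
      rw [negEigCount_fromBlocks hA.1 (isHermitian_diagonal _),
        negEigCount_eq_zero_of_posSemidef hA, negEigCount_diagonal]
      simp [ht])).2
  have h2 : k ≠ 0 → f (-t) ≠ 0 := by
    intro hk hft
    have h3 := (H (Fin k) (diagonal fun _ => -t) (by simp; omega) (isHermitian_diagonal _)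
      (by
        intro i j
        by_cases h : i = j
        · simpa [h] using htI'
        · simpa [h] using memI_zero hρ)
      (by rw [negEigCount_diagonal]; simp [ht])).2
    rw [diagonal_map h0, det_diagonal, det_diagonal] at h3
    simp [hft, hk, ht.ne'] at h3
  rw [fromBlocks_map, Matrix.map_zero f h0, Matrix.map_zero f h0, diagonal_map h0,
    det_fromBlocks_zero₁₂, det_fromBlocks_zero₁₂, det_diagonal, det_diagonal] at h1
  have h4 : ∏ _i : Fin k, f (-t) ≠ 0 := by
    rw [Finset.prod_const, Finset.card_univ, Fintype.card_fin]
    rcases eq_or_ne k 0 with rfl | hk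
    · simp
    · exact pow_ne_zero _ (h2 hk)
  have h5 : ∏ _i : Fin k, -t ≠ 0 := Finset.prod_ne_zero_iff.2 fun _ _ => by simpa using ht.ne'
  exact ⟨fun h => (mul_eq_zero.1 (h1.1 (mul_eq_zero.2 (.inl h)))).resolve_right h5,
    fun h => (mul_eq_zero.1 (h1.2 (mul_eq_zero.2 (.inl h)))).resolve_right h4⟩

lemma PreservesNegDet.map_pos (H : PreservesNegDet ρ k f) {a : ℝ} (ha : 0 < a)
    (haI : memI ρ a) (hρ : 0 < ρ) : 0 < f a := by
  have h0 := H.map_zero hρ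
  have hne : f a ≠ 0 := by
    have h := H.det_map_eq_zero_iff hρ (A := diagonal fun _ : Unit => a)
      (PosSemidef.diagonal fun _ => ha.le) (by simpa using haI)
    rw [diagonal_map h0] at h
    simpa [ha.ne'] using h
  by_contra! hle
  have hlt : f a < 0 := lt_of_le_of_ne hle hne
  have hD : ∀ (n : ℕ) (s : ℝ), negEigCount (diagonal fun _ : Fin n => s) =
      if s < 0 then n else 0 := by
    intro n s
    rw [negEigCount_diagonal]
    split_ifs with h <;> simp [h]
  have h1 := (H (Fin k ⊕ Fin (k + 1)) (fromBlocks (diagonal fun _ => -a) 0 0 (diagonal fun _ => a))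
    (by simp; omega)
    ((isHermitian_diagonal _).fromBlocks (by simp) (isHermitian_diagonal _))
    (by
      rintro (i | i) (j | j)
      · by_cases h : i = j
        · simpa [h] using haI.of_abs_le (abs_neg a).le
        · simpa [h] using memI_zero hρ
      · exact memI_zero hρ
      · exact memI_zero hρ
      · by_cases h : i = j
        · simpa [h] using haI
        · simpa [h] using memI_zero hρ)
    (by
      rw [negEigCount_fromBlocks (isHermitian_diagonal _) (isHermitian_diagonal _), hD, hD]
      simp [ha, ha.le])).1
  rw [fromBlocks_map, Matrix.map_zero f h0, Matrix.map_zero f h0, diagonal_map h0,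
    diagonal_map h0, negEigCount_fromBlocks (isHermitian_diagonal _) (isHermitian_diagonal _),
    hD, hD, if_pos hlt] at h1
  omega

/-- The image of the Gram matrix of three vectors in the plane is singular. -/
lemma PreservesNegDet.det_gram_eq_zero (H : PreservesNegDet ρ k f) (hρ : 0 < ρ)
    (u v : Fin 3 → ℝ) (hI : ∀ i j, memI ρ (u i * u j + v i * v j)) :
    (Matrix.of fun i j => f (u i * u j + v i * v j)).det = 0 := by
  have hA : (Matrix.of fun i j => u i * u j + v i * v j) = vecMulVec u u + vecMulVec v v := by
    ext i j
    simp [vecMulVec_apply]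
  have hpsd : (Matrix.of fun i j => u i * u j + v i * v j).PosSemidef := by
    rw [hA]
    exact (by simpa using posSemidef_vecMulVec_self_star u : (vecMulVec u u).PosSemidef).add
      (by simpa using posSemidef_vecMulVec_self_star v)
  refine (H.det_map_eq_zero_iff hρ hpsd hI).2 ?_
  rw [det_fin_three]
  simp only [Matrix.of_apply]
  ring

lemma PreservesNegDet.map_add (H : PreservesNegDet ρ k f) (hρ : 0 < ρ) {x y : ℝ} (hx : 0 < x)
    (hy : 0 < y) (hI : memI ρ (x + y)) : f (x + y) = f x + f y := by
  have hxI : memI ρ x := hI.of_abs_le (abs_le_abs_of_nonneg hx.le (by linarith))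
  have hyI : memI ρ y := hI.of_abs_le (abs_le_abs_of_nonneg hy.le (by linarith))
  have hx2 := Real.mul_self_sqrt hx.le
  have hy2 := Real.mul_self_sqrt hy.le
  have h := H.det_gram_eq_zero hρ ![√x, 0, √x] ![0, √y, √y] (by
    intro i j
    fin_cases i <;> fin_cases j <;> simp [hx2, hy2, hxI, hyI, hI, memI_zero hρ])
  rw [det_fin_three] at h
  simp [hx2, hy2, H.map_zero hρ] at h
  have hfx := H.map_pos hx hxI hρ
  have hfy := H.map_pos hy hyI hρ
  have h' : f x * f y * (f (x + y) - (f x + f y)) = 0 := by linear_combination h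
  have := (mul_eq_zero.1 h').resolve_left (mul_pos hfx hfy).ne'
  linarith

lemma PreservesNegDet.map_neg_eq_or (H : PreservesNegDet ρ k f) {c : ℝ} (hc : 0 < c)
    (hlin : ∀ x, 0 < x → memI ρ x → f x = c * x) (hρ : 0 < ρ) {a b : ℝ} (ha : 0 < a) (hb : 0 < b)
    (hI : memI ρ (a + 2 * b)) : f (-a) = -(c * a) ∨ f (-a) = c * (a + 2 * b) := by
  have hle : ∀ {x}, |x| ≤ a + 2 * b → memI ρ x := fun h =>
    hI.of_abs_le (h.trans (le_abs_self _))
  have hp := Real.mul_self_sqrt (add_pos ha hb).le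
  have hr := Real.mul_self_sqrt hb.le
  set p := √(a + b)
  set r := √b
  have hdiag : memI ρ (a + b + b) := hle (by rw [abs_of_pos] <;> linarith)
  have hoff : memI ρ (-a) := hle (by rw [abs_of_neg] <;> linarith)
  have hbI : memI ρ b := hle (by rw [abs_of_pos] <;> linarith)
  have h := H.det_gram_eq_zero hρ ![p, -p, 0] ![r, r, r] (by
    intro i j
    fin_cases i <;> fin_cases j <;> simp [hp, hr] <;> assumption)
  rw [det_fin_three] at h
  have e : -(a + b) + b = -a := by ring
  simp only [Matrix.of_apply, cons_val_zero, cons_val_one, cons_val, mul_neg, neg_mul, neg_neg,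
    mul_zero, zero_mul, neg_zero, zero_add, hp, hr, e] at h
  rw [hlin _ (by linarith) hdiag, hlin b hb hbI] at h
  have h' : (c * b) * ((f (-a) + c * a) * (f (-a) - c * (a + 2 * b))) = 0 := by
    linear_combination -h
  rcases mul_eq_zero.1 ((mul_eq_zero.1 h').resolve_left (mul_pos hc hb).ne') with h | h
  · left; linarith
  · right; linarith

lemma PreservesNegDet.exists_homothety (H : PreservesNegDet ρ k f) (hρ : 0 < ρ) :
    ∃ c : ℝ, 0 < c ∧ ∀ x : ℝ, memI ρ x → f x = c * x := by
  obtain ⟨t, ht, htI⟩ := (memI_zero hρ).exists_gt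
  rw [abs_zero] at ht
  have hc : 0 < f t / t := div_pos (H.map_pos ht htI hρ) ht
  have hlin : ∀ x, 0 < x → memI ρ x → f x = f t / t * x := by
    intro x hx hxI
    have := mul_eq_mul_of_additive_of_pos (fun x hx hxI => H.map_pos hx hxI hρ)
      (fun x y hx hy hI => H.map_add hρ hx hy hI) ht hx htI hxI
    field_simp
    linarith
  refine ⟨f t / t, hc, fun x hxI => ?_⟩
  set c := f t / t
  rcases lt_trichotomy x 0 with hx | rfl | hx
  · obtain ⟨y, hxy, hyI⟩ := hxI.exists_gt
    rw [abs_of_neg hx] at hxy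
    have hb : ∀ b, 0 < b → -x + 2 * b ≤ y → f x = c * x ∨ f x = c * (-x + 2 * b) := by
      intro b hb hle
      simpa using H.map_neg_eq_or hc hlin hρ (neg_pos.2 hx) hb
        (hyI.of_abs_le (abs_le_abs_of_nonneg (by linarith) hle))
    rcases hb ((y + x) / 2) (by linarith) (by linarith) with h | h
    · exact h
    rcases hb ((y + x) / 4) (by linarith) (by linarith) with h2 | h2
    · exact h2
    · rw [h] at h2
      have := mul_left_cancel₀ hc.ne' h2
      linarith
  · rw [H.map_zero hρ, mul_zero]
  · exact hlin x hx hxI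

end Preserver

/-- Theorem 1.2: the entrywise transform `f[-]` preserves the inertia of all matrices in
`S^(k)((-ρ,ρ))` if and only if `f` is a positive homothety. -/
theorem inertia_preserver_iff_homothety (ρ : EReal) (hρ : 0 < ρ) (k : ℕ) (f : ℝ → ℝ) :
    (∀ n : ℕ, max k 1 ≤ n → ∀ A : Matrix (Fin n) (Fin n) ℝ,
        A.IsSymm → (∀ i j, memI ρ (A i j)) → negEigCount A = k →
        (posEigCount (A.map f) = posEigCount A ∧
         negEigCount (A.map f) = negEigCount A ∧
         zeroEigCount (A.map f) = zeroEigCount A)) ↔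
    (∃ c : ℝ, 0 < c ∧ ∀ x : ℝ, memI ρ x → f x = c * x) := by
  constructor
  · intro H
    exact (preservesNegDet_of_inertia H).exists_homothety hρ
  · rintro ⟨c, hc, hf⟩ n - A hA hI -
    have hmap : A.map f = c • A := by
      ext i j
      simp [hf _ (hI i j)]
    rw [hmap]
    exact eigCounts_smul (by rwa [Matrix.IsHermitian, conjTranspose_eq_transpose_of_trivial]) hc
end

section
/- Let I = (−ρ, ρ) where 0 < ρ ≤ ∞, and let l be a positive integer. A function f : I → ℝ satisfies: for every n ≥ 1 and every positive semidefinite n×n matrix A with entries in I, the entrywise transform f[A] has at most l negative eigenvalues, if and only if f is represented on I by a convergent power series f(x) = Σ_{n=0}^∞ c_n x^n for all x ∈ (−ρ, ρ), with c_n ≥ 0 for all n ≥ 1 (with c_0 ∈ ℝ arbitrary). -/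
open Matrix in
/-- Positive semidefiniteness of a real matrix, as a double sum. -/
lemma posSemidef_iff_sum {ι : Type*} [Fintype ι] {A : Matrix ι ι ℝ} :
    A.PosSemidef ↔ A.IsHermitian ∧ ∀ x : ι → ℝ, 0 ≤ ∑ i, ∑ j, x i * A i j * x j := by
  rw [posSemidef_iff_dotProduct_mulVec]
  simp only [dotProduct, mulVec, Pi.star_apply, star_trivial, Finset.mul_sum, mul_assoc]

open Matrix in
/-- Diagonalisation of the quadratic form of a real symmetric matrix. -/
lemma Matrix.IsHermitian.sum_eq_sum_eigenvalues {ι : Type*} [Fintype ι] [DecidableEq ι]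
    {A : Matrix ι ι ℝ} (hA : A.IsHermitian) (x : ι → ℝ) :
    ∑ i, ∑ j, x i * A i j * x j =
      ∑ k, hA.eigenvalues k * (∑ i, hA.eigenvectorBasis k i * x i) ^ 2 := by
  have key : x ⬝ᵥ A *ᵥ x =
      inner ℝ (WithLp.toLp 2 x) (WithLp.toLp 2 (A *ᵥ x) : EuclideanSpace ℝ ι) := by
    simp [PiLp.inner_apply, dotProduct, mul_comm]
  have h1 : ∑ i, ∑ j, x i * A i j * x j = x ⬝ᵥ A *ᵥ x := by
    simp only [dotProduct, mulVec, Finset.mul_sum, mul_assoc]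
  rw [h1, key, ← hA.eigenvectorBasis.sum_inner_mul_inner]
  refine Finset.sum_congr rfl fun k _ => ?_
  have h2 : inner ℝ (hA.eigenvectorBasis k) (WithLp.toLp 2 (A *ᵥ x) : EuclideanSpace ℝ ι) =
      hA.eigenvalues k * ∑ i, hA.eigenvectorBasis k i * x i := by
    have h3 : inner ℝ (hA.eigenvectorBasis k) (WithLp.toLp 2 (A *ᵥ x) : EuclideanSpace ℝ ι) =
        (A *ᵥ (hA.eigenvectorBasis k)) ⬝ᵥ x := by
      have : (A *ᵥ (hA.eigenvectorBasis k)) = (hA.eigenvectorBasis k : ι → ℝ) ᵥ* A := by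
        rw [← mulVec_transpose]
        congr 1
        simpa [IsHermitian] using hA.symm
      rw [this, ← dotProduct_mulVec]
      simp [PiLp.inner_apply, dotProduct, mul_comm]
    rw [h3, hA.mulVec_eigenvectorBasis]
    simp [dotProduct, Finset.mul_sum, mul_assoc]
  have h4 : inner ℝ (WithLp.toLp 2 x : EuclideanSpace ℝ ι) (hA.eigenvectorBasis k) =
      ∑ i, hA.eigenvectorBasis k i * x i := by
    simp [PiLp.inner_apply]
  rw [h2, h4]
  ring

/-- A linear space of vectors of dimension larger than the number of negative eigenvalues
contains a nonzero vector on which the quadratic form is nonnegative, even after imposing one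
more linear condition. -/
lemma exists_ne_zero_sum_nonneg {ι κ : Type*} [Fintype ι] [DecidableEq ι] [Fintype κ]
    {A : Matrix ι ι ℝ} (hA : A.IsHermitian) (hc : negEigCount A + 1 < Fintype.card κ)
    (L : (κ → ℝ) →ₗ[ℝ] (ι → ℝ)) (φ : (κ → ℝ) →ₗ[ℝ] ℝ) :
    ∃ t : κ → ℝ, t ≠ 0 ∧ φ t = 0 ∧ 0 ≤ ∑ i, ∑ j, L t i * A i j * L t j := by
  classical
  rw [negEigCount, dif_pos hA, Nat.card_eq_fintype_card] at hc
  let F : (κ → ℝ) →ₗ[ℝ] ({k // hA.eigenvalues k < 0} → ℝ) × ℝ :=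
    (LinearMap.pi fun k : {k // hA.eigenvalues k < 0} =>
      ∑ i, hA.eigenvectorBasis k i • (LinearMap.proj i ∘ₗ L)).prod φ
  obtain ⟨t, ht, ht0⟩ := (Submodule.ne_bot_iff _).1
    (LinearMap.ker_ne_bot_of_finrank_lt (f := F) (by simpa using hc))
  have hF : F t = 0 := ht
  refine ⟨t, ht0, congrArg Prod.snd hF, ?_⟩
  rw [hA.sum_eq_sum_eigenvalues]
  refine Finset.sum_nonneg fun k _ => ?_
  by_cases hk : hA.eigenvalues k < 0
  · have : ∑ i, hA.eigenvectorBasis k i * L t i = 0 := by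
      have := congrFun (congrArg Prod.fst hF) ⟨k, hk⟩
      simpa [F] using this
    simp [this]
  · exact mul_nonneg (not_lt.1 hk) (sq_nonneg _)

/-- If the quadratic form is nonnegative on vectors with zero coordinate sum, there is at most
one negative eigenvalue. -/
lemma negEigCount_le_one {ι : Type*} [Fintype ι] [DecidableEq ι] {A : Matrix ι ι ℝ}
    (h : ∀ x : ι → ℝ, ∑ i, x i = 0 → 0 ≤ ∑ i, ∑ j, x i * A i j * x j) :
    negEigCount A ≤ 1 := by
  rw [negEigCount]
  split_ifs with hA
  swap
  · exact zero_le_one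
  rw [Nat.card_eq_fintype_card]
  by_contra! hc
  let e := hA.eigenvectorBasis
  let V : ({k // hA.eigenvalues k < 0} → ℝ) →ₗ[ℝ] EuclideanSpace ℝ ι :=
    Fintype.linearCombination ℝ (fun k : {k // hA.eigenvalues k < 0} => e k)
  let F : ({k // hA.eigenvalues k < 0} → ℝ) →ₗ[ℝ] ℝ :=
    ∑ i, LinearMap.proj i ∘ₗ (WithLp.linearEquiv 2 ℝ (ι → ℝ)).toLinearMap ∘ₗ V
  obtain ⟨t, ht, ht0⟩ := (Submodule.ne_bot_iff _).1
    (LinearMap.ker_ne_bot_of_finrank_lt (f := F) (by simpa using hc))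
  have hF : F t = 0 := ht
  have h1 := h (fun i => V t i) (by simpa [F] using hF)
  rw [hA.sum_eq_sum_eigenvalues] at h1
  have h2 : ∀ k, ∑ i, hA.eigenvectorBasis k i * V t i =
      if hk : hA.eigenvalues k < 0 then t ⟨k, hk⟩ else 0 := by
    intro k
    have h3 : ∑ i, hA.eigenvectorBasis k i * V t i = inner ℝ (e k) (V t) := by
      simp [PiLp.inner_apply, e, mul_comm]
    rw [h3]
    simp only [V, Fintype.linearCombination_apply, inner_sum, inner_smul_right,
      orthonormal_iff_ite.1 e.orthonormal, mul_ite, mul_one, mul_zero]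
    split_ifs with hk
    · rw [Finset.sum_eq_single ⟨k, hk⟩] <;> simp +contextual [Subtype.ext_iff, eq_comm]
    · refine Finset.sum_eq_zero fun x _ => ?_
      rw [if_neg]
      rintro rfl
      exact hk x.2
  have h5 : ∑ k, hA.eigenvalues k * (∑ i, hA.eigenvectorBasis k i * V t i) ^ 2 < 0 := by
    obtain ⟨⟨k, hk⟩, hk0⟩ := Function.ne_iff.1 ht0
    refine Finset.sum_neg' (fun k _ => ?_) ⟨k, Finset.mem_univ _, ?_⟩
    · rw [h2]
      split_ifs with hk
      · exact mul_nonpos_of_nonpos_of_nonneg hk.le (sq_nonneg _)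
      · simp
    · rw [h2, dif_pos hk]
      exact mul_neg_of_neg_of_pos hk (by simpa [sq_pos_iff] using hk0)
  exact absurd h1 h5.not_ge

/-- `g` preserves, entrywise, positive semidefiniteness of matrices with entries in `(-s, s)`. -/
def PreservesPSD (s : ℝ) (g : ℝ → ℝ) : Prop :=
  ∀ (n : ℕ) (A : Matrix (Fin n) (Fin n) ℝ), A.PosSemidef → (∀ i j, |A i j| < s) →
    (A.map g).PosSemidef

/-- The central difference operator with half-step `ε`. -/
def centralDiff (ε : ℝ) (g : ℝ → ℝ) : ℝ → ℝ := fun x => g (x + ε) - g (x - ε)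

namespace PreservesPSD

variable {s : ℝ} {g : ℝ → ℝ}

lemma map_posSemidef (hg : PreservesPSD s g) {ι : Type*} [Fintype ι] {A : Matrix ι ι ℝ}
    (hA : A.PosSemidef) (hs : ∀ i j, |A i j| < s) : (A.map g).PosSemidef := by
  let e := Fintype.equivFin ι
  have := hg _ _ (hA.submatrix e.symm) fun i j => hs _ _
  simpa [Matrix.submatrix_map] using this.submatrix e

/-- Central differences of a positivity preserver are positivity preservers. -/
lemma preserves_centralDiff (hg : PreservesPSD s g) {ε : ℝ} (hε : 0 ≤ ε) :
    PreservesPSD (s - ε) (centralDiff ε g) := by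
  intro n A hA hs
  let σ : Bool → ℝ := fun b => if b then 1 else -1
  let u : Fin n × Bool → ℝ := fun p => σ p.2
  have hB : (A.submatrix Prod.fst Prod.fst +
      ε • Matrix.vecMulVec u (star u)).PosSemidef :=
    (hA.submatrix Prod.fst).add ((Matrix.posSemidef_vecMulVec_self_star u).smul hε)
  have hσ : ∀ a b, |σ a * σ b| = 1 := by
    intro a b
    cases a <;> cases b <;> simp [σ]
  have hB' := hg.map_posSemidef hB (by
    intro p q
    have h1 := hs p.1 q.1
    have h2 : |ε * (u p * u q)| = ε := by
      rw [abs_mul, hσ, mul_one, abs_of_nonneg hε]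
    have h3 := abs_add_le (A p.1 q.1) (ε * (u p * u q))
    simp only [Matrix.add_apply, Matrix.submatrix_apply, Matrix.smul_apply,
      Matrix.vecMulVec_apply, smul_eq_mul, star_trivial]
    linarith)
  rw [posSemidef_iff_sum] at hB' ⊢
  refine ⟨hA.isHermitian.map _ fun _ => rfl, fun x => ?_⟩
  have h := hB'.2 fun p => x p.1 * σ p.2
  simp only [Fintype.sum_prod_type, Fintype.sum_bool, Matrix.map_apply, Matrix.add_apply,
    Matrix.submatrix_apply, Matrix.smul_apply, Matrix.vecMulVec_apply, smul_eq_mul,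
    star_trivial, u, σ, if_true, Bool.false_eq_true, if_false, mul_one, mul_neg,
    ← Finset.sum_add_distrib, ← sub_eq_add_neg] at h
  have h2 : ∑ i, ∑ j, x i * A.map (centralDiff ε g) i j * x j =
      (1 / 2) * ∑ i, ∑ j, (x i * g (A i j + ε) * x j - x i * g (A i j - ε) * x j +
        (-(x i) * g (A i j - ε) * x j - -(x i) * g (A i j + ε) * x j)) := by
    simp only [Finset.mul_sum, Matrix.map_apply, centralDiff]
    refine Finset.sum_congr rfl fun i _ => Finset.sum_congr rfl fun j _ => ?_
    ring
  rw [h2]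
  simp only [sub_neg_eq_add] at h
  exact mul_nonneg (by norm_num) h

lemma abs_le (hg : PreservesPSD s g) {x y : ℝ} (hyx : |y| ≤ x) (hx : x < s) :
    |g y| ≤ g x := by
  have hx0 : 0 ≤ x := (abs_nonneg y).trans hyx
  obtain ⟨h1, h2⟩ := _root_.abs_le.1 hyx
  have hA : (!![x, y; y, x] : Matrix (Fin 2) (Fin 2) ℝ).PosSemidef := by
    rw [posSemidef_iff_sum]
    refine ⟨?_, fun v => ?_⟩
    · ext i j
      fin_cases i <;> fin_cases j <;> rfl
    · simp only [Fin.sum_univ_two, Matrix.of_apply, Matrix.cons_val', Matrix.cons_val_zero,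
        Matrix.cons_val_one, Matrix.cons_val_fin_one]
      nlinarith [mul_nonneg (by linarith : 0 ≤ x + y) (sq_nonneg (v 0 + v 1)),
        mul_nonneg (by linarith : 0 ≤ x - y) (sq_nonneg (v 0 - v 1))]
  have h := hg.map_posSemidef hA (by
    intro i j
    fin_cases i <;> fin_cases j <;> simp [abs_of_nonneg hx0, hx, hyx.trans_lt hx])
  rw [posSemidef_iff_sum] at h
  have h3 := h.2 ![1, 1]
  have h4 := h.2 ![1, -1]
  simp [Fin.sum_univ_two] at h3 h4
  exact _root_.abs_le.2 ⟨by linarith, by linarith⟩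

/-- Replicating a matrix along the diagonal shows that a transform with boundedly many negative
eigenvalues becomes positivity preserving after subtracting its value at zero. -/
lemma of_negEigCount_le {f : ℝ → ℝ} {l : ℕ} (hs : 0 < s)
    (H : ∀ n : ℕ, 1 ≤ n → ∀ A : Matrix (Fin n) (Fin n) ℝ, A.PosSemidef →
      (∀ i j, |A i j| < s) → negEigCount (A.map f) ≤ l) :
    PreservesPSD s (fun x => f x - f 0) := by
  intro n A hA hAs
  rw [posSemidef_iff_sum]
  refine ⟨hA.isHermitian.map _ fun _ => rfl, fun v => ?_⟩
  rcases Nat.eq_zero_or_pos n with rfl | hn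
  · simp
  let e : Fin (n * (l + 2)) ≃ Fin n × Fin (l + 2) := finProdFinEquiv.symm
  let C : Matrix (Fin n × Fin (l + 2)) (Fin n × Fin (l + 2)) ℝ :=
    (A.submatrix Prod.fst Prod.fst).hadamard
      ((1 : Matrix (Fin (l + 2)) (Fin (l + 2)) ℝ).submatrix Prod.snd Prod.snd)
  have hC : C.PosSemidef := (hA.submatrix _).hadamard (Matrix.PosSemidef.one.submatrix _)
  have hCa : ∀ p q, C p q = if p.2 = q.2 then A p.1 q.1 else 0 := by
    intro p q
    simp [C, Matrix.one_apply]
  have hB := hC.submatrix e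
  have hle := H _ (Nat.mul_pos hn (by omega)) _ hB (by
    intro i j
    rw [Matrix.submatrix_apply, hCa]
    split_ifs
    · exact hAs _ _
    · simpa using hs)
  let L : (Fin (l + 2) → ℝ) →ₗ[ℝ] (Fin (n * (l + 2)) → ℝ) :=
    LinearMap.pi fun i => v (e i).1 • LinearMap.proj (e i).2
  obtain ⟨t, ht0, htφ, ht⟩ := exists_ne_zero_sum_nonneg (κ := Fin (l + 2))
    (hB.isHermitian.map f fun _ => rfl) (by simpa using by omega) L
    (∑ a, LinearMap.proj a)
  have hsum : ∑ a, t a = 0 := by simpa using htφ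
  have h1 : ∑ i, ∑ j, L t i * ((C.submatrix e e).map f) i j * L t j =
      ∑ p : Fin n × Fin (l + 2), ∑ q : Fin n × Fin (l + 2),
        (v p.1 * t p.2) * f (C p q) * (v q.1 * t q.2) := by
    rw [← e.sum_comp]
    refine Finset.sum_congr rfl fun i _ => ?_
    rw [← e.sum_comp]
    simp [L]
  have h2 : ∀ p q, f (C p q) = f 0 + if p.2 = q.2 then f (A p.1 q.1) - f 0 else 0 := by
    intro p q
    rw [hCa]
    split_ifs <;> simp
  have h3 : ∑ p : Fin n × Fin (l + 2), ∑ q : Fin n × Fin (l + 2),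
        (v p.1 * t p.2) * f (C p q) * (v q.1 * t q.2) =
      f 0 * (∑ i, v i) ^ 2 * (∑ a, t a) ^ 2 +
      (∑ i, ∑ j, v i * (A.map fun x => f x - f 0) i j * v j) * ∑ a, t a ^ 2 := by
    have e1 : f 0 * (∑ i, v i) ^ 2 * (∑ a, t a) ^ 2 =
        ∑ i, ∑ a, ∑ j, ∑ b, (v i * t a) * f 0 * (v j * t b) := by
      have e2 : ∀ i a j, ∑ b, (v i * t a) * f 0 * (v j * t b) =
          v i * t a * f 0 * v j * ∑ b, t b := by
        intro i a j
        rw [Finset.mul_sum]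
        exact Finset.sum_congr rfl fun _ _ => by ring
      simp only [e2, ← Finset.sum_mul, ← Finset.mul_sum]
      ring
    have e3 : (∑ i, ∑ j, v i * (A.map fun x => f x - f 0) i j * v j) * ∑ a, t a ^ 2 =
        ∑ i, ∑ a, ∑ j, v i * (f (A i j) - f 0) * v j * t a ^ 2 := by
      rw [Finset.sum_mul]
      refine Finset.sum_congr rfl fun i _ => ?_
      simp only [← Finset.sum_mul, ← Finset.mul_sum, Matrix.map_apply]
    rw [e1, e3]
    simp only [Fintype.sum_prod_type, h2, ← Finset.sum_add_distrib]
    refine Finset.sum_congr rfl fun i _ => Finset.sum_congr rfl fun a _ =>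
      Finset.sum_congr rfl fun j _ => ?_
    have e4 : v i * (f (A i j) - f 0) * v j * t a ^ 2 =
        ∑ b, if a = b then v i * (f (A i j) - f 0) * v j * (t a * t b) else 0 := by
      simp [sq]
    rw [e4, ← Finset.sum_add_distrib]
    refine Finset.sum_congr rfl fun b _ => ?_
    split_ifs <;> ring
  rw [h1, h3, hsum] at ht
  have h4 : 0 < ∑ a, t a ^ 2 := by
    obtain ⟨a, ha⟩ := Function.ne_iff.1 ht0
    exact Finset.sum_pos' (fun _ _ => sq_nonneg _) ⟨a, Finset.mem_univ _, by
      simpa [sq_pos_iff] using ha⟩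
  refine nonneg_of_mul_nonneg_left (b := ∑ a, t a ^ 2) ?_ h4
  simpa using ht

end PreservesPSD

lemma fwdDiff_iterate_comp (g : ℝ → ℝ) (ε : ℝ) (k j : ℕ) :
    (fwdDiff 1)^[k] (fun i : ℕ => g (2 * i * ε)) j =
      (centralDiff ε)^[k] g ((k + 2 * j) * ε) := by
  induction k generalizing j with
  | zero => simp
  | succ k ih =>
    rw [Function.iterate_succ_apply', Function.iterate_succ_apply', fwdDiff, ih, ih, centralDiff]
    push_cast
    rw [show (k + 1 + 2 * j) * ε + ε = (k + 2 * (j + 1)) * ε by ring,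
      show (k + 1 + 2 * j) * ε - ε = (k + 2 * j) * ε by ring]

lemma fwdDiff_iterate_comp_neg (g : ℝ → ℝ) (ε : ℝ) (k j : ℕ) :
    (fwdDiff 1)^[k] (fun i : ℕ => g (-(2 * i * ε))) j =
      (-1) ^ k * (centralDiff ε)^[k] g (-((k + 2 * j) * ε)) := by
  induction k generalizing j with
  | zero => simp
  | succ k ih =>
    rw [Function.iterate_succ_apply', Function.iterate_succ_apply', fwdDiff, ih, ih, centralDiff]
    push_cast
    rw [show -((k + 1 + 2 * j) * ε) + ε = -((k + 2 * j) * ε) by ring,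
      show -((k + 1 + 2 * j) * ε) - ε = -((k + 2 * (j + 1)) * ε) by ring]
    ring

/-- The coefficients, in the monomial basis, of a polynomial in Bernstein form are given by
forward differences. -/
lemma sum_bernstein_eq_sum_fwdDiff (u : ℕ → ℝ) (N : ℕ) (x : ℝ) :
    ∑ k ∈ Finset.range (N + 1), (N.choose k : ℝ) * x ^ k * (1 - x) ^ (N - k) * u k =
      ∑ k ∈ Finset.range (N + 1), (N.choose k : ℝ) * (fwdDiff 1)^[k] u 0 * x ^ k := by
  let T : Module.End ℝ (ℕ → ℝ) := LinearMap.funLeft ℝ ℝ (· + 1)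
  have hT : ∀ k (w : ℕ → ℝ) j, (T ^ k) w j = w (j + k) := by
    intro k
    induction k with
    | zero => simp
    | succ k ih =>
      intro w j
      rw [pow_succ, Module.End.mul_apply, ih]
      simp [T, LinearMap.funLeft_apply, add_assoc]
  have hD : ∀ k (w : ℕ → ℝ), ((T - 1) ^ k) w = (fwdDiff 1)^[k] w := by
    intro k
    induction k with
    | zero => simp
    | succ k ih =>
      intro w
      rw [pow_succ, Module.End.mul_apply, ih, Function.iterate_succ_apply]
      congr 1
  have h : ((x • T + (1 - x) • 1) ^ N) u 0 = ((x • (T - 1) + 1) ^ N) u 0 := by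
    rw [show x • T + (1 - x) • 1 = x • (T - 1) + 1 by module]
  rw [Commute.add_pow ((Commute.one_right _).smul_right _), (Commute.one_right _).add_pow] at h
  simp only [LinearMap.sum_apply, Finset.sum_apply, smul_pow, one_pow, mul_one] at h
  refine Eq.trans (Finset.sum_congr rfl fun k _ => ?_)
    (h.trans (Finset.sum_congr rfl fun k _ => ?_))
  · rw [← nsmul_eq_mul', ← Nat.cast_smul_eq_nsmul ℝ]
    simp [hT]
    ring
  · rw [← nsmul_eq_mul', ← Nat.cast_smul_eq_nsmul ℝ]
    simp [hD]
    ring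

/-- If the monomial coefficients of the Bernstein polynomials of a continuous function are bounded
and converge along a subsequence, then the limit coefficients sum to the function. -/
lemma hasSum_of_tendsto_fwdDiff {G : ℝ → ℝ} (hG : ContinuousOn G (Set.Icc 0 1)) {φ : ℕ → ℕ}
    (hφ : Filter.Tendsto φ Filter.atTop Filter.atTop) {M : ℝ} {α : ℕ → ℝ}
    (hb : ∀ n k, |((φ n).choose k : ℝ) * (fwdDiff 1)^[k] (fun j : ℕ => G (j / φ n)) 0| ≤ M)
    (hlim : ∀ k, Filter.Tendsto
      (fun n => ((φ n).choose k : ℝ) * (fwdDiff 1)^[k] (fun j : ℕ => G (j / φ n)) 0)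
      Filter.atTop (nhds (α k)))
    {x : ℝ} (hx0 : 0 ≤ x) (hx1 : x < 1) : HasSum (fun k => α k * x ^ k) (G x) := by
  set a : ℕ → ℕ → ℝ := fun n k =>
    ((φ n).choose k : ℝ) * (fwdDiff 1)^[k] (fun j : ℕ => G (j / φ n)) 0 with ha
  have hgeo : Summable fun k : ℕ => M * x ^ k :=
    (summable_geometric_of_lt_one hx0 hx1).mul_left M
  have hα : ∀ k, |α k| ≤ M := fun k => le_of_tendsto (hlim k).abs (.of_forall fun n => hb n k)
  have hbd : ∀ c : ℝ, |c| ≤ M → ∀ k, ‖c * x ^ k‖ ≤ M * x ^ k := by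
    intro c hc k
    rw [norm_mul, norm_pow, Real.norm_of_nonneg hx0]
    exact mul_le_mul_of_nonneg_right hc (pow_nonneg hx0 k)
  have hsum : Summable fun k => α k * x ^ k :=
    Summable.of_norm_bounded hgeo fun k => hbd _ (hα k) k
  have h1 : Filter.Tendsto (fun n => ∑' k, a n k * x ^ k) Filter.atTop
      (nhds (∑' k, α k * x ^ k)) :=
    tendsto_tsum_of_dominated_convergence hgeo (fun k => (hlim k).mul_const _)
      (.of_forall fun n k => hbd _ (hb n k) k)
  let G' : C(unitInterval, ℝ) := ⟨fun y => G y, hG.domRestrict⟩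
  let x' : unitInterval := ⟨x, hx0, hx1.le⟩
  have h2 : ∀ n, ∑' k, a n k * x ^ k = bernsteinApproximation (φ n) G' x' := by
    intro n
    rw [tsum_eq_sum (s := Finset.range (φ n + 1)), ← sum_bernstein_eq_sum_fwdDiff,
      bernsteinApproximation.apply, Finset.sum_range]
    · refine Finset.sum_congr rfl fun k _ => ?_
      rw [bernstein_apply, smul_eq_mul]
      rfl
    · intro k hk
      simp [ha, Nat.choose_eq_zero_of_lt (not_le.1 fun h => hk (Finset.mem_range_succ_iff.2 h))]
  have h3 : Filter.Tendsto (fun n => bernsteinApproximation (φ n) G' x') Filter.atTop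
      (nhds (G x)) :=
    ((continuous_eval_const x').tendsto G').comp
      ((bernsteinApproximation_uniform G').comp hφ)
  simp only [h2] at h1
  rw [tendsto_nhds_unique h3 h1]
  exact hsum.hasSum

namespace PreservesPSD

variable {s : ℝ} {g : ℝ → ℝ}

lemma nonneg (hg : PreservesPSD s g) {x : ℝ} (hx0 : 0 ≤ x) (hx : x < s) : 0 ≤ g x :=
  (abs_nonneg _).trans (hg.abs_le (abs_of_nonneg hx0).le hx)

lemma iterate_centralDiff (hg : PreservesPSD s g) {ε : ℝ} (hε : 0 ≤ ε) (k : ℕ) :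
    PreservesPSD (s - k * ε) ((centralDiff ε)^[k] g) := by
  induction k with
  | zero => simpa using hg
  | succ k ih =>
    rw [Function.iterate_succ_apply']
    have := ih.preserves_centralDiff hε
    rwa [sub_sub, ← add_one_mul, ← Nat.cast_succ] at this

lemma abs_sub_le (hg : PreservesPSD s g) {u v y : ℝ} (hvu : v ≤ u) (hy : |(u + v) / 2| ≤ y)
    (hs : y + (u - v) / 2 < s) :
    |g u - g v| ≤ g (y + (u - v) / 2) - g (y - (u - v) / 2) := by
  have h := (hg.preserves_centralDiff (ε := (u - v) / 2) (by linarith)).abs_le hy (by linarith)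
  simpa only [centralDiff, show (u + v) / 2 + (u - v) / 2 = u by ring,
    show (u + v) / 2 - (u - v) / 2 = v by ring] using h

lemma continuousOn (hg : PreservesPSD s g) {r : ℝ} (hr0 : 0 ≤ r) (hr : r < s) :
    ContinuousOn g (Set.Icc (-r) r) := by
  set R := (r + s) / 2 with hR
  have hrR : r < R := by linarith
  have hRs : R < s := by linarith
  have key : ∀ (K : ℕ) (u v : ℝ), v ≤ u → -r ≤ v → u ≤ r → K * (u - v) ≤ R - r →
      K * |g u - g v| ≤ g R := by
    intro K u v hvu hv hu hK
    have h1 : ∀ j ∈ Finset.range K, |g u - g v| ≤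
        g (r + (j + 1 : ℕ) * (u - v)) - g (r + (j : ℕ) * (u - v)) := by
      intro j hj
      have hj' : ((j : ℝ) + 1) * (u - v) ≤ K * (u - v) :=
        mul_le_mul_of_nonneg_right (by exact_mod_cast Finset.mem_range.1 hj) (by linarith)
      have hj0 : 0 ≤ (j : ℝ) * (u - v) := mul_nonneg (Nat.cast_nonneg _) (by linarith)
      have h2 := hg.abs_sub_le (y := r + (j : ℝ) * (u - v) + (u - v) / 2) hvu
        (_root_.abs_le.2 ⟨by linarith, by linarith⟩) (by linarith)
      push_cast
      convert h2 using 3 <;> ring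
    have h2 := Finset.sum_le_sum h1
    rw [Finset.sum_range_sub (fun j : ℕ => g (r + j * (u - v)))] at h2
    simp only [Finset.sum_const, Finset.card_range, nsmul_eq_mul, Nat.cast_zero, zero_mul,
      add_zero] at h2
    have h3 := hg.nonneg hr0 hr
    have h4 : 0 ≤ (K : ℝ) * (u - v) := mul_nonneg (Nat.cast_nonneg _) (by linarith)
    have h5 := hg.abs_le (x := R) (y := r + K * (u - v))
      (by rw [abs_of_nonneg (by linarith)]; linarith) hRs
    linarith [le_abs_self (g (r + K * (u - v)))]
  rw [Metric.continuousOn_iff]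
  intro v hv ε hε
  obtain ⟨K, hK⟩ := exists_nat_gt (g R / ε)
  have hK0 : (0 : ℝ) < K := (div_nonneg (hg.nonneg (hr0.trans hrR.le) hRs) hε.le).trans_lt hK
  rw [div_lt_iff₀ hε] at hK
  refine ⟨(R - r) / K, div_pos (by linarith) hK0, fun u hu huv => ?_⟩
  rw [Real.dist_eq, lt_div_iff₀ hK0, mul_comm] at huv
  rw [Real.dist_eq]
  refine lt_of_mul_lt_mul_left (lt_of_le_of_lt ?_ hK) hK0.le
  rcases le_total v u with h | h
  · rw [abs_of_nonneg (by linarith)] at huv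
    exact key K u v h hv.1 hu.2 huv.le
  · rw [abs_of_nonpos (by linarith)] at huv
    rw [abs_sub_comm]
    exact key K v u h hu.1 hv.2 (by linarith)

/-- A difference of values at symmetric points is controlled by higher central differences. -/
lemma abs_iterate_centralDiff_sub_le (hg : PreservesPSD s g) {ε : ℝ} (hε : 0 ≤ ε) (k : ℕ)
    (hk : 2 * (k + 1) * ε < s) :
    |(centralDiff ε)^[k] g (k * ε) - (centralDiff ε)^[k] g (-(k * ε))| ≤
      k * (centralDiff ε)^[k + 1] g ((k + 1) * ε) := by
  set F := (centralDiff ε)^[k] g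
  have h1 := Finset.sum_range_sub (fun i : ℕ => F ((2 * i - k) * ε)) k
  have h2 : F (k * ε) - F (-(k * ε)) = ∑ i ∈ Finset.range k,
      (F ((2 * (i + 1 : ℕ) - k) * ε) - F ((2 * (i : ℕ) - k) * ε)) := by
    rw [h1]
    congr 2 <;> push_cast <;> ring
  rw [h2]
  refine (Finset.abs_sum_le_sum_abs _ _).trans ?_
  rw [← nsmul_eq_mul]
  refine (Finset.sum_le_card_nsmul _ _ ((centralDiff ε)^[k + 1] g ((k + 1) * ε))
    fun i hi => ?_).trans_eq (by rw [Finset.card_range])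
  have hik : (i : ℝ) + 1 ≤ k := by exact_mod_cast Finset.mem_range.1 hi
  have hi0 : (0 : ℝ) ≤ i := Nat.cast_nonneg i
  have h3 := (hg.iterate_centralDiff hε (k + 1)).abs_le (x := (k + 1) * ε)
    (y := (2 * i + 1 - k) * ε) (by
      rw [abs_mul, abs_of_nonneg hε]
      exact mul_le_mul_of_nonneg_right (_root_.abs_le.2 ⟨by linarith, by linarith⟩) hε)
    (by push_cast; linarith)
  refine le_trans (le_of_eq ?_) h3
  rw [Function.iterate_succ_apply', centralDiff]
  push_cast
  congr 3 <;> ring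

end PreservesPSD

/-- Two real power series with the same sum near zero have the same coefficients. -/
lemma eq_of_hasSum_pow {c d : ℕ → ℝ} {g : ℝ → ℝ} {r : ℝ} (hr : 0 < r)
    (hc : ∀ x, |x| < r → HasSum (fun n => c n * x ^ n) (g x))
    (hd : ∀ x, |x| < r → HasSum (fun n => d n * x ^ n) (g x)) : c = d := by
  have key : ∀ c : ℕ → ℝ, (∀ x, |x| < r → HasSum (fun n => c n * x ^ n) (g x)) →
      HasFPowerSeriesAt g (FormalMultilinearSeries.ofScalars ℝ c) 0 := by
    intro c hc
    rw [hasFPowerSeriesAt_iff]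
    filter_upwards [Metric.ball_mem_nhds (0 : ℝ) hr] with z hz
    have := hc z (by simpa using hz)
    simpa [FormalMultilinearSeries.coeff_ofScalars, mul_comm] using this
  have h := (key c hc).eq_formalMultilinearSeries (key d hd)
  exact (FormalMultilinearSeries.ofScalars_series_eq_iff (𝕜 := ℝ) ℝ c d).1 h

/-- **Schoenberg theorem** on a compact subinterval: entrywise positivity preservers are power
series with nonnegative coefficients. -/
lemma PreservesPSD.exists_hasSum {s : ℝ} {g : ℝ → ℝ} (hg : PreservesPSD s g) {r : ℝ}
    (hr0 : 0 < r) (hr : r < s) :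
    ∃ c : ℕ → ℝ, (∀ n, 0 ≤ c n) ∧ ∀ x, |x| < r → HasSum (fun n => c n * x ^ n) (g x) := by
  let a : ℕ → ℕ → ℝ := fun N k =>
    (N.choose k : ℝ) * (fwdDiff 1)^[k] (fun j : ℕ => g (r * (j / N))) 0
  let b : ℕ → ℕ → ℝ := fun N k =>
    (N.choose k : ℝ) * (fwdDiff 1)^[k] (fun j : ℕ => g (-(r * (j / N)))) 0
  let ε : ℕ → ℝ := fun N => r / (2 * N)
  have hε0 : ∀ N, 0 ≤ ε N := fun N => by positivity
  have hεN : ∀ N k : ℕ, k ≤ N → 2 * k * ε N ≤ r := by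
    intro N k hk
    rcases N.eq_zero_or_pos with rfl | hN
    · simp [ε, hr0.le]
    · have hN' : (0 : ℝ) < N := by exact_mod_cast hN
      have hk' : (k : ℝ) ≤ N := by exact_mod_cast hk
      simp only [ε]
      rw [mul_div_assoc', div_le_iff₀ (by positivity)]
      nlinarith
  have ha : ∀ N k, a N k = (N.choose k : ℝ) * (centralDiff (ε N))^[k] g (k * ε N) := by
    intro N k
    have h := fwdDiff_iterate_comp g (ε N) k 0
    simp only [Nat.cast_zero, mul_zero, add_zero] at h
    rw [← h]
    simp only [a, ε]
    congr! 4 with j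
    ring
  have hb : ∀ N k, b N k =
      (N.choose k : ℝ) * ((-1) ^ k * (centralDiff (ε N))^[k] g (-(k * ε N))) := by
    intro N k
    have h := fwdDiff_iterate_comp_neg g (ε N) k 0
    simp only [Nat.cast_zero, mul_zero, add_zero] at h
    rw [← h]
    simp only [b, ε]
    congr! 5 with j
    ring
  have hF : ∀ N k, k ≤ N → ∀ y, |y| ≤ k * ε N →
      |(centralDiff (ε N))^[k] g y| ≤ (centralDiff (ε N))^[k] g (k * ε N) := fun N k hk y hy =>
    (hg.iterate_centralDiff (hε0 N) k).abs_le hy (by linarith [hεN N k hk])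
  have hzero : ∀ N k, N < k → a N k = 0 ∧ b N k = 0 := by
    intro N k hk
    simp [a, b, Nat.choose_eq_zero_of_lt hk]
  have ha0 : ∀ N k, 0 ≤ a N k := by
    intro N k
    rcases le_or_gt k N with hk | hk
    · rw [ha]
      exact mul_nonneg (Nat.cast_nonneg _) ((abs_nonneg _).trans (hF N k hk (k * ε N)
        (abs_of_nonneg (mul_nonneg (Nat.cast_nonneg _) (hε0 N))).le))
    · exact (hzero N k hk).1.ge
  have hba : ∀ N k, |b N k| ≤ a N k := by
    intro N k
    rcases le_or_gt k N with hk | hk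
    · rw [ha, hb, abs_mul, abs_mul, abs_pow, abs_neg, abs_one, one_pow, one_mul, Nat.abs_cast]
      refine mul_le_mul_of_nonneg_left (hF N k hk _ ?_) (Nat.cast_nonneg _)
      rw [abs_neg, abs_of_nonneg (mul_nonneg (Nat.cast_nonneg _) (hε0 N))]
    · simp [hzero N k hk]
  have haM : ∀ N k, N ≠ 0 → a N k ≤ g r := by
    intro N k hN
    rcases le_or_gt k N with hk | hk
    · have h := sum_bernstein_eq_sum_fwdDiff (fun j : ℕ => g (r * (j / N))) N 1
      rw [Finset.sum_eq_single_of_mem N (by simp)] at h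
      · have hN' : (N : ℝ) ≠ 0 := by exact_mod_cast hN
        simp only [one_pow, mul_one, Nat.choose_self, Nat.cast_one, sub_self, tsub_self, pow_zero,
          one_mul, div_self hN'] at h
        rw [h]
        exact Finset.single_le_sum (f := a N) (fun i _ => ha0 N i)
          (Finset.mem_range_succ_iff.2 hk)
      · intro i hi hiN
        have : N - i ≠ 0 := by
          have := Finset.mem_range_succ_iff.1 hi
          omega
        simp [this]
    · rw [(hzero N k hk).1]
      exact hg.nonneg hr0.le hr
  have hdiff : ∀ N k, k < N → |a N k - (-1) ^ k * b N k| ≤ k * (k + 1) * g r / (N - k) := by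
    intro N k hk
    have h1 := hg.abs_iterate_centralDiff_sub_le (hε0 N) k
      (lt_of_le_of_lt (by simpa using hεN N (k + 1) hk) hr)
    have hNk : (0 : ℝ) < N - k := sub_pos.2 (by exact_mod_cast hk)
    have h2 : a N k - (-1) ^ k * b N k = (N.choose k : ℝ) *
        ((centralDiff (ε N))^[k] g (k * ε N) - (centralDiff (ε N))^[k] g (-(k * ε N))) := by
      have : ((-1 : ℝ) ^ k) * (-1) ^ k = 1 := by rw [← mul_pow]; simp
      rw [ha, hb]
      linear_combination (-(N.choose k : ℝ) * (centralDiff (ε N))^[k] g (-(k * ε N))) * this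
    have h3 : (N.choose k : ℝ) * (N - k) = N.choose (k + 1) * (k + 1) := by
      have := Nat.choose_succ_right_eq N k
      rw [← Nat.cast_sub hk.le]
      exact_mod_cast this.symm
    have h4 := haM N (k + 1) (by omega)
    rw [ha] at h4
    push_cast at h4
    rw [le_div_iff₀ hNk, h2, abs_mul, Nat.abs_cast]
    calc _ = (N.choose k * (N - k : ℝ)) *
          |(centralDiff (ε N))^[k] g (k * ε N) - (centralDiff (ε N))^[k] g (-(k * ε N))| := by
          ring
      _ ≤ (N.choose (k + 1) * (k + 1 : ℝ)) *
          (k * (centralDiff (ε N))^[k + 1] g ((k + 1) * ε N)) := by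
          rw [h3]
          gcongr
      _ = k * (k + 1) *
          (N.choose (k + 1) * (centralDiff (ε N))^[k + 1] g ((k + 1) * ε N)) := by ring
      _ ≤ k * (k + 1) * g r := by gcongr
  have hcomp : IsCompact (Set.univ.pi fun _ : ℕ => Set.Icc 0 (g r)) :=
    isCompact_univ_pi fun _ => isCompact_Icc
  obtain ⟨α, hα, ψ, hψ, hlim⟩ := hcomp.tendsto_subseq (x := fun n => a (n + 1))
    fun n k _ => ⟨ha0 _ _, haM _ _ n.succ_ne_zero⟩
  let φ : ℕ → ℕ := fun n => ψ n + 1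
  have hφ : Filter.Tendsto φ Filter.atTop Filter.atTop :=
    (Filter.tendsto_add_atTop_nat 1).comp hψ.tendsto_atTop
  have hlim_a : ∀ k, Filter.Tendsto (fun n => a (φ n) k) Filter.atTop (nhds (α k)) :=
    tendsto_pi_nhds.1 hlim
  have hlim_b : ∀ k, Filter.Tendsto (fun n => b (φ n) k) Filter.atTop
      (nhds ((-1) ^ k * α k)) := by
    intro k
    have h1 : Filter.Tendsto (fun n => a (φ n) k - (-1) ^ k * b (φ n) k) Filter.atTop
        (nhds 0) := by
      refine squeeze_zero_norm' (a := fun n => k * (k + 1) * g r / ((φ n : ℝ) - k)) ?_ ?_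
      · filter_upwards [hφ.eventually_gt_atTop k] with n hn
        exact hdiff _ _ hn
      · exact Filter.Tendsto.const_div_atTop (Filter.tendsto_atTop_add_const_right _ _
          (tendsto_natCast_atTop_atTop.comp hφ)) _
    have h2 := ((hlim_a k).sub h1).const_mul ((-1) ^ k)
    rw [sub_zero] at h2
    refine h2.congr fun n => ?_
    have : ((-1 : ℝ) ^ k) * (-1) ^ k = 1 := by rw [← mul_pow]; simp
    linear_combination b (φ n) k * this
  have hcont := hg.continuousOn hr0.le hr
  have hpos : ∀ x, 0 ≤ x → x < 1 → HasSum (fun k => α k * x ^ k) (g (r * x)) := fun x hx0 hx1 =>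
    hasSum_of_tendsto_fwdDiff (G := fun x => g (r * x))
      (hcont.comp (by fun_prop) fun y hy => ⟨by nlinarith [hy.1], by nlinarith [hy.2]⟩) hφ
      (fun n k => (abs_of_nonneg (ha0 _ _)).trans_le (haM _ k (ψ n).succ_ne_zero))
      hlim_a hx0 hx1
  have hneg : ∀ x, 0 ≤ x → x < 1 →
      HasSum (fun k => ((-1) ^ k * α k) * x ^ k) (g (-(r * x))) := fun x hx0 hx1 =>
    hasSum_of_tendsto_fwdDiff (G := fun x => g (-(r * x)))
      (hcont.comp (by fun_prop) fun y hy => ⟨by nlinarith [hy.2], by nlinarith [hy.1]⟩) hφ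
      (fun n k => (hba _ _).trans (haM _ k (ψ n).succ_ne_zero))
      hlim_b hx0 hx1
  refine ⟨fun k => α k / r ^ k, fun k => div_nonneg (hα k trivial).1 (by positivity),
    fun x hx => ?_⟩
  have hx1 : |x| / r < 1 := (div_lt_one hr0).2 hx
  rcases le_total 0 x with h0 | h0
  · rw [abs_of_nonneg h0] at hx1
    have h := hpos (x / r) (by positivity) hx1
    rw [mul_div_cancel₀ _ hr0.ne'] at h
    convert h using 2 with k
    rw [div_pow]
    ring
  · rw [abs_of_nonpos h0] at hx1
    have h := hneg (-x / r) (div_nonneg (by linarith) hr0.le) hx1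
    rw [mul_div_cancel₀ _ hr0.ne', neg_neg] at h
    convert h using 2 with k
    rw [div_pow, neg_pow x]
    have : ((-1 : ℝ) ^ k) * (-1) ^ k = 1 := by rw [← mul_pow]; simp
    linear_combination (-(α k * x ^ k / r ^ k)) * this

/-- A power series with nonnegative coefficients maps, entrywise, positive semidefinite matrices
to matrices with nonnegative quadratic form. -/
lemma Matrix.PosSemidef.sum_nonneg_of_hasSum {ι : Type*} [Fintype ι] {A : Matrix ι ι ℝ}
    (hA : A.PosSemidef) {c : ℕ → ℝ} (hc : ∀ n, 0 ≤ c n) {B : Matrix ι ι ℝ}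
    (hB : ∀ i j, HasSum (fun n => c n * A i j ^ n) (B i j)) (x : ι → ℝ) :
    0 ≤ ∑ i, ∑ j, x i * B i j * x j := by
  have hpow : ∀ n : ℕ, (Matrix.of fun i j => A i j ^ n).PosSemidef := by
    intro n
    induction n with
    | zero =>
      convert Matrix.posSemidef_vecMulVec_self_star (fun _ : ι => (1 : ℝ)) using 1
      ext i j
      simp [Matrix.vecMulVec_apply]
    | succ n ih =>
      have h := ih.hadamard hA
      rwa [show (Matrix.of fun i j => A i j ^ n).hadamard A =
        Matrix.of fun i j => A i j ^ (n + 1) from by ext; simp [pow_succ]] at h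
  have h := hasSum_sum fun i (_ : i ∈ Finset.univ) => hasSum_sum fun j (_ : j ∈ Finset.univ) =>
    ((hB i j).mul_left (x i)).mul_right (x j)
  refine h.nonneg fun n => ?_
  have h1 := (posSemidef_iff_sum.1 (hpow n)).2 x
  refine (mul_nonneg (hc n) h1).trans_eq ?_
  simp only [Finset.mul_sum, Matrix.of_apply]
  exact Finset.sum_congr rfl fun i _ => Finset.sum_congr rfl fun j _ => by ring

lemma memI_of_abs_lt {ρ : EReal} {s x : ℝ} (hs : (s : EReal) ≤ ρ) (hx : |x| < s) :
    memI ρ x := by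
  obtain ⟨h1, h2⟩ := abs_lt.1 hx
  refine ⟨?_, (EReal.coe_lt_coe_iff.2 h2).trans_le hs⟩
  refine (EReal.neg_le_neg_iff.2 hs).trans_lt ?_
  exact_mod_cast h1

lemma abs_lt_of_memI {ρ : EReal} {x : ℝ} (hx : memI ρ x) : ((|x| : ℝ) : EReal) < ρ := by
  rcases abs_choice x with h | h <;> rw [h]
  · exact hx.2
  · rw [EReal.coe_neg]
    exact EReal.neg_lt_comm.1 hx.1

/-- Theorem A (the case `k = 0`, `l ≥ 1`): `f[-]` sends the positive semidefinite matrices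
with entries in `(-ρ,ρ)` into the matrices with at most `l` negative eigenvalues (for every
size `n ≥ 1`) if and only if `f` is given on `(-ρ,ρ)` by a convergent power series
`Σ cₙ xⁿ` with `cₙ ≥ 0` for all `n ≥ 1`. -/
theorem psd_to_atMostL_iff (ρ : EReal) (hρ : 0 < ρ) (l : ℕ) (hl : 1 ≤ l) (f : ℝ → ℝ) :
    (∀ n : ℕ, 1 ≤ n → ∀ A : Matrix (Fin n) (Fin n) ℝ,
        A.PosSemidef → (∀ i j, memI ρ (A i j)) →
        negEigCount (A.map f) ≤ l) ↔
    (∃ c : ℕ → ℝ, (∀ n : ℕ, 1 ≤ n → 0 ≤ c n) ∧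
      ∀ x : ℝ, memI ρ x → HasSum (fun n : ℕ => c n * x ^ n) (f x)) := by
  constructor
  · intro H
    have hloc : ∀ r : ℝ, 0 < r → (r : EReal) < ρ → ∃ c : ℕ → ℝ, (∀ n, 0 ≤ c n) ∧
        ∀ x, |x| < r → HasSum (fun n => c n * x ^ n) (f x - f 0) := by
      intro r hr0 hr
      obtain ⟨s, hrs, hs⟩ := EReal.lt_iff_exists_real_btwn.1 hr
      rw [EReal.coe_lt_coe_iff] at hrs
      exact (PreservesPSD.of_negEigCount_le (hr0.trans hrs) fun n hn A hA hAs =>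
        H n hn A hA fun i j => memI_of_abs_lt hs.le (hAs i j)).exists_hasSum hr0 hrs
    obtain ⟨r₀, hr₀, hr₀ρ⟩ := EReal.lt_iff_exists_real_btwn.1 hρ
    rw [EReal.coe_pos] at hr₀
    obtain ⟨c, hc0, hc⟩ := hloc r₀ hr₀ hr₀ρ
    refine ⟨fun n => c n + if n = 0 then f 0 else 0, fun n hn => ?_, fun x hx => ?_⟩
    · simpa [Nat.one_le_iff_ne_zero.1 hn] using hc0 n
    have hmax : ((max |x| r₀ : ℝ) : EReal) < ρ := by
      rcases max_choice |x| r₀ with h | h <;> rw [h]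
      exacts [abs_lt_of_memI hx, hr₀ρ]
    obtain ⟨r, hr, hrρ⟩ := EReal.lt_iff_exists_real_btwn.1 hmax
    rw [EReal.coe_lt_coe_iff, max_lt_iff] at hr
    obtain ⟨d, -, hd⟩ := hloc r (hr₀.trans hr.2) hrρ
    have hcd : c = d := eq_of_hasSum_pow hr₀ hc fun y hy => hd y (hy.trans hr.2)
    have h := (hd x hr.1).add (hasSum_ite_eq 0 (f 0))
    rw [sub_add_cancel] at h
    convert h using 2 with n
    rw [hcd]
    split_ifs with hn
    · simp [hn]
    · simp [hn]
  · rintro ⟨c, hc, hf⟩ n - A hA hAI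
    refine (negEigCount_le_one fun x hx => ?_).trans hl
    have h := hA.sum_nonneg_of_hasSum (c := fun k => if k = 0 then 0 else c k)
      (B := Matrix.of fun i j => f (A i j) - c 0)
      (fun k => by
        split_ifs with hk
        exacts [le_rfl, hc k (Nat.one_le_iff_ne_zero.2 hk)])
      (fun i j => by
        have h1 := (hf _ (hAI i j)).sub (hasSum_ite_eq 0 (c 0))
        refine h1.congr_fun fun k => ?_
        split_ifs with hk
        · simp [hk]
        · simp) x
    refine h.trans_eq ?_
    have h2 : ∑ i, ∑ j, x i * c 0 * x j = 0 := by
      simp [← Finset.mul_sum, hx]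
    rw [← sub_zero (∑ i, ∑ j, x i * A.map f i j * x j), ← h2]
    simp only [← Finset.sum_sub_distrib, Matrix.map_apply, Matrix.of_apply]
    exact Finset.sum_congr rfl fun i _ => Finset.sum_congr rfl fun j _ => by ring
end
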